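/- arXiv:1503.02160 — 2 statements merged into one kernel-verified Lean document; each statement's English description precedes it below -/
import Mathlib

section
/- Let α, a, b > 0 with α ≤ a < 2α and ab ∈ [(M−1)/M, M/(M+1)) for some integer M ≥ 2, and let κ ∈ {0,1,…,M−1} be the largest integer with (1−ab)κ ≤ bα. Suppose h : ℝ → ℝ satisfies h(x) = 0 for all x outside the set S := −(⋃_{k=1}^{κ} [k/b, ak+α]) ∪ [−α, α] ∪ ⋃_{k=1}^{κ} [k/b, ak+α]. Then for every n ∈ {1, …, κ} and every x ∈ (α + a(n−1), n/b) one has h(x) = h(x+a) = 0, and for every n ∈ {−1, …, −κ} and every x ∈ (n/b − a, an − α) one has h(x) = h(x+a) = 0. -/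
open MeasureTheory Filter Set Topology

/-- `κ ∈ {0, 1, …, M-1}` is the largest integer with `(1-ab)κ ≤ bα`. -/
def IsKappa (α a b : ℝ) (M κ : ℕ) : Prop :=
  κ ≤ M - 1 ∧ (1 - a * b) * (κ : ℝ) ≤ b * α ∧
    ∀ j : ℕ, j ≤ M - 1 → (1 - a * b) * (j : ℝ) ≤ b * α → j ≤ κ

/-- Lemma (a): if `h` vanishes outside
`-(⋃_{k=1}^κ [k/b, ak+α]) ∪ [-α, α] ∪ ⋃_{k=1}^κ [k/b, ak+α]`, then
`h(x) = h(x+a) = 0` for `n = 1,…,κ`, `x ∈ (α+a(n-1), n/b)`, and for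
`n = -1,…,-κ`, `x ∈ (n/b - a, an - α)`. -/
theorem vanishing_lemma_a (α a b : ℝ) (M κ : ℕ) (h : ℝ → ℝ)
    (hα : 0 < α) (hb : 0 < b)
    (ha₁ : α ≤ a) (ha₂ : a < 2 * α)
    (hM : 2 ≤ M)
    (hab₁ : ((M : ℝ) - 1) / (M : ℝ) ≤ a * b) (hab₂ : a * b < (M : ℝ) / ((M : ℝ) + 1))
    (hκ : IsKappa α a b M κ)
    (hvanish : ∀ x : ℝ,
      x ∉ ((fun t : ℝ => -t) '' (⋃ k ∈ Finset.Icc 1 κ, Set.Icc ((k : ℝ) / b) (a * k + α))) ∪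
          Set.Icc (-α) α ∪ (⋃ k ∈ Finset.Icc 1 κ, Set.Icc ((k : ℝ) / b) (a * k + α)) →
      h x = 0) :
    (∀ n : ℕ, 1 ≤ n → n ≤ κ →
      ∀ x ∈ Set.Ioo (α + a * ((n : ℝ) - 1)) ((n : ℝ) / b), h x = 0 ∧ h (x + a) = 0) ∧
    (∀ n : ℕ, 1 ≤ n → n ≤ κ →
      ∀ x ∈ Set.Ioo ((-(n : ℝ)) / b - a) (a * (-(n : ℝ)) - α), h x = 0 ∧ h (x + a) = 0) := by
  have ha : 0 < a := lt_of_lt_of_le hα ha₁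
  have hab : a * b < 1 := by
    refine hab₂.trans ?_
    rw [div_lt_one (by positivity)]
    linarith
  have hainv : a < 1 / b := by rwa [lt_div_iff₀ hb]
  -- a point strictly between two consecutive intervals is in none of them
  have gap : ∀ (m : ℕ) (y : ℝ), α + a * (m : ℝ) < y → y < ((m : ℝ) + 1) / b →
      ∀ k : ℕ, (k : ℝ) / b ≤ y → y ≤ a * k + α → False := by
    intro m y h1 h2 k h3 h4
    rcases le_or_gt k m with hk | hk
    · have hk' : (k : ℝ) ≤ m := by exact_mod_cast hk
      have := mul_le_mul_of_nonneg_left hk' ha.le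
      linarith
    · have hk' : (m : ℝ) + 1 ≤ k := by exact_mod_cast hk
      have := div_le_div_of_nonneg_right hk' hb.le
      linarith
  have key : ∀ (m : ℕ) (y : ℝ), α + a * (m : ℝ) < y → y < ((m : ℝ) + 1) / b →
      h y = 0 ∧ h (-y) = 0 := by
    intro m y h1 h2
    have hm : 0 ≤ a * (m : ℝ) := by positivity
    have hpos : ∀ k : ℕ, 0 ≤ (k : ℝ) / b := fun k => by positivity
    constructor
    · apply hvanish
      simp only [Set.mem_union, Set.mem_image, Set.mem_iUnion, Set.mem_Icc, exists_prop]
      rintro ((⟨t, ⟨k, -, h3, h4⟩, h5⟩ | ⟨h3, h4⟩) | ⟨k, -, h3, h4⟩)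
      · linarith [hpos k]
      · linarith
      · exact gap m y h1 h2 k h3 h4
    · apply hvanish
      simp only [Set.mem_union, Set.mem_image, Set.mem_iUnion, Set.mem_Icc, exists_prop]
      rintro ((⟨t, ⟨k, -, h3, h4⟩, h5⟩ | ⟨h3, h4⟩) | ⟨k, -, h3, h4⟩)
      · have : t = y := by linarith
        subst this
        exact gap m t h1 h2 k h3 h4
      · linarith
      · linarith [hpos k]
  constructor
  · rintro n hn - x ⟨h1, h2⟩
    obtain ⟨m, rfl⟩ : ∃ m, n = m + 1 := ⟨n - 1, by omega⟩
    push_cast at h1 h2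
    refine ⟨(key m x (by linarith) h2).1, (key (m + 1) (x + a) ?_ ?_).1⟩
    · push_cast; linarith
    · push_cast; rw [add_div ((m : ℝ) + 1)]; linarith
  · rintro n hn - x ⟨h1, h2⟩
    obtain ⟨m, rfl⟩ : ∃ m, n = m + 1 := ⟨n - 1, by omega⟩
    rw [neg_div] at h1
    push_cast at h1 h2
    constructor
    · have := (key (m + 1) (-x) (by push_cast; linarith)
        (by push_cast; rw [add_div ((m : ℝ) + 1)]; linarith)).2
      simpa using this
    · have := (key m (-(x + a)) (by linarith) (by linarith)).2
      rwa [neg_neg] at this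
end

section
/- Let α, a, b > 0 with α ≤ a < 2α and ab ∈ [(M−1)/M, M/(M+1)) for some integer M ≥ 2, and let κ ∈ {0,1,…,M−1} be the largest integer with (1−ab)κ ≤ bα. Suppose h : ℝ → ℝ satisfies h(x) = 0 for all x outside the set S := −(⋃_{k=1}^{κ} [k/b, ak+α]) ∪ [−α, α] ∪ ⋃_{k=1}^{κ} [k/b, ak+α]. Then for every integer n with κ+1 ≤ |n| ≤ M−1 and every x ∈ [n/b − a, n/b], one has h(x) = h(x+a) = 0. -/
open MeasureTheory Filter Set Topology

/-- Lemma (b): if `h` vanishes outside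
`-(⋃_{k=1}^κ [k/b, ak+α]) ∪ [-α, α] ∪ ⋃_{k=1}^κ [k/b, ak+α]`, then
`h(x) = h(x+a) = 0` for every integer `n` with `κ+1 ≤ |n| ≤ M-1` and `x ∈ [n/b - a, n/b]`. -/
theorem vanishing_lemma_b (α a b : ℝ) (M κ : ℕ) (h : ℝ → ℝ)
    (hα : 0 < α) (hb : 0 < b)
    (ha₁ : α ≤ a) (ha₂ : a < 2 * α)
    (hM : 2 ≤ M)
    (hab₁ : ((M : ℝ) - 1) / (M : ℝ) ≤ a * b) (hab₂ : a * b < (M : ℝ) / ((M : ℝ) + 1))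
    (hκ : IsKappa α a b M κ)
    (hvanish : ∀ x : ℝ,
      x ∉ ((fun t : ℝ => -t) '' (⋃ k ∈ Finset.Icc 1 κ, Set.Icc ((k : ℝ) / b) (a * k + α))) ∪
          Set.Icc (-α) α ∪ (⋃ k ∈ Finset.Icc 1 κ, Set.Icc ((k : ℝ) / b) (a * k + α)) →
      h x = 0) :
    ∀ n : ℤ, κ + 1 ≤ n.natAbs → n.natAbs ≤ M - 1 →
      ∀ x ∈ Set.Icc ((n : ℝ) / b - a) ((n : ℝ) / b), h x = 0 ∧ h (x + a) = 0 := by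
  obtain ⟨h1, h2, h3⟩ := hκ
  have ha : 0 < a := lt_of_lt_of_le hα ha₁
  have hU : ∀ y ∈ (⋃ k ∈ Finset.Icc 1 κ, Set.Icc ((k : ℝ) / b) (a * k + α)),
      0 ≤ y ∧ y ≤ a * κ + α := by
    intro y hy
    simp only [Set.mem_iUnion, Finset.mem_Icc, Set.mem_Icc] at hy
    obtain ⟨k, ⟨_, hk⟩, hy1, hy2⟩ := hy
    have hk' : (k : ℝ) ≤ κ := by exact_mod_cast hk
    have h0 : (0 : ℝ) ≤ (k : ℝ) / b := by positivity
    exact ⟨h0.trans hy1, by nlinarith⟩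
  have hκ0 : 0 ≤ a * (κ : ℝ) := by positivity
  have key : ∀ y : ℝ, a * κ + α < |y| → h y = 0 := by
    intro y hy
    apply hvanish
    rintro ((⟨t, ht, rfl⟩ | hm) | hm)
    · have := hU t ht
      simp only [abs_neg] at hy
      rw [abs_of_nonneg this.1] at hy
      linarith
    · have := abs_le.mpr hm
      linarith
    · have := hU y hm
      rw [abs_of_nonneg this.1] at hy
      linarith
  intro n hn1 hn2 x hx
  have h4 : b * α < (1 - a * b) * ((κ + 1 : ℕ) : ℝ) := by
    by_contra hc
    have := h3 (κ + 1) (hn1.trans hn2) (not_lt.mp hc)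
    omega
  push_cast at h4
  have h5 : a * κ + α < ((κ : ℝ) + 1) / b - a := by
    rw [lt_sub_iff_add_lt, lt_div_iff₀ hb]
    nlinarith
  obtain ⟨hx1, hx2⟩ := hx
  rcases le_total 0 n with hn | hn
  · have h6 : (κ : ℝ) + 1 ≤ n := by
      have : (κ : ℤ) + 1 ≤ n := by omega
      exact_mod_cast this
    have h7 : ((κ : ℝ) + 1) / b ≤ n / b := by gcongr
    constructor
    · exact key _ (lt_of_lt_of_le (by linarith) (le_abs_self x))
    · exact key _ (lt_of_lt_of_le (by linarith) (le_abs_self (x + a)))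
  · have h6 : (n : ℝ) ≤ -((κ : ℝ) + 1) := by
      have : n ≤ -((κ : ℤ) + 1) := by omega
      exact_mod_cast this
    have h7 : (n : ℝ) / b ≤ -((κ : ℝ) + 1) / b := by gcongr
    rw [neg_div] at h7
    constructor
    · exact key _ (lt_of_lt_of_le (by linarith) (neg_le_abs x))
    · exact key _ (lt_of_lt_of_le (by linarith) (neg_le_abs (x + a)))
end
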